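/- There does not exist a Z/13Z-regular Fano Kaleidoscope FK(13); equivalently, there is no Fano Kaleidoscopic difference family FKDF(13) in Z/13Z. -/

import Mathlib

section KaleidoscopeDefs

variable {G V : Type*}

/-- The multiset of differences `x - y` over ordered pairs of distinct elements of `B`. -/
def diffMultiset [AddGroup G] [DecidableEq G] (B : Finset G) : Multiset G :=
  ((B ×ˢ B).filter fun p => p.1 ≠ p.2).val.map fun p => p.1 - p.2

/-- A `(G, k, lam)`-difference family, given as a multiset of blocks. -/
def IsDiffFamily [AddGroup G] [DecidableEq G] (k lam : ℕ) (𝓕 : Multiset (Finset G)) : Prop :=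
  (∀ B ∈ 𝓕, B.card = k) ∧ ∀ g : G, g ≠ 0 → (𝓕.bind diffMultiset).count g = lam

/-- The `j`-th line `{b_j, b_{j+1}, b_{j+3}}` (indices mod 7) of an ordered 7-tuple. -/
def fanoLine [DecidableEq G] (B : Fin 7 → G) (j : Fin 7) : Finset G :=
  {B j, B (j + 1), B (j + 3)}

/-- A Fano Kaleidoscopic difference family: a family of ordered 7-tuples of distinct
elements such that for each `j` the family of `j`-th lines is a `(G,3,1)`-DF. -/
def IsFKDF [AddGroup G] [DecidableEq G] (𝓕 : Multiset (Fin 7 → G)) : Prop :=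
  (∀ B ∈ 𝓕, Function.Injective B) ∧
    ∀ j : Fin 7, IsDiffFamily 3 1 (𝓕.map fun B => fanoLine B j)

/-- The `i`-th line of an ordered 9-tuple `(binf, b_0, …, b_7)`:
`{b_i, b_{i+1}, b_{i+3}}` (indices mod 8) for `0 ≤ i ≤ 7`, and
`{binf, b_{i-8}, b_{i-4}}` for `8 ≤ i ≤ 11`. -/
def hesseLine [DecidableEq G] (binf : G) (b : Fin 8 → G) (i : Fin 12) : Finset G :=
  if h : (i : ℕ) < 8 then
    {b ⟨i, h⟩, b (⟨i, h⟩ + 1), b (⟨i, h⟩ + 3)}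
  else
    {binf, b ⟨(i : ℕ) - 8, by have := i.isLt; omega⟩,
      b (⟨(i : ℕ) - 8, by have := i.isLt; omega⟩ + 4)}

/-- A Hesse Kaleidoscopic difference family: a family of ordered 9-tuples of distinct
elements such that for each `i` the family of `i`-th lines is a `(G,3,1)`-DF. -/
def IsHKDF [AddGroup G] [DecidableEq G] (𝓕 : Multiset (G × (Fin 8 → G))) : Prop :=
  (∀ B ∈ 𝓕, Function.Injective B.2 ∧ ∀ k, B.1 ≠ B.2 k) ∧
    ∀ i : Fin 12, IsDiffFamily 3 1 (𝓕.map fun B => hesseLine B.1 B.2 i)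

/-- The point set of a colored plane given by its (colored) lines. -/
def linesPts [DecidableEq V] {n : ℕ} (L : Fin n → Finset V) : Finset V :=
  Finset.univ.biUnion L

/-- `L` describes a Fano plane with points in `V`, where `L i` is the line colored `c_i`:
7 points, seven 3-element lines, and any two distinct points on exactly one line. -/
def IsColoredFano [DecidableEq V] (L : Fin 7 → Finset V) : Prop :=
  (linesPts L).card = 7 ∧ (∀ i, (L i).card = 3) ∧
    ∀ x y : V, x ∈ linesPts L → y ∈ linesPts L → x ≠ y →
      ∃! i : Fin 7, x ∈ L i ∧ y ∈ L i

/-- A Fano Kaleidoscope on the point set `V`: a multiset of line-colored Fano planes such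
that for all distinct `x y` and every color `i` exactly one plane has `x, y` on its
`c_i`-colored line. -/
def IsFanoKaleidoscope [DecidableEq V] (K : Multiset (Fin 7 → Finset V)) : Prop :=
  (∀ L ∈ K, IsColoredFano L) ∧
    ∀ x y : V, x ≠ y → ∀ i : Fin 7,
      Multiset.countP (fun L => x ∈ L i ∧ y ∈ L i) K = 1

/-- A `G`-regular Fano Kaleidoscope: a Fano Kaleidoscope with point set `G` invariant
(with colors) under all translations. -/
def IsRegularFK (G : Type*) [AddGroup G] [DecidableEq G]
    (K : Multiset (Fin 7 → Finset G)) : Prop :=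
  IsFanoKaleidoscope K ∧ ∀ g : G, K.map (fun L => fun i => (L i).image (· + g)) = K

/-- `L` describes a Hesse plane (an `AG(2,3)`) with points in `V`, where `L i` is the line
colored `c_i`. -/
def IsColoredHesse [DecidableEq V] (L : Fin 12 → Finset V) : Prop :=
  (linesPts L).card = 9 ∧ (∀ i, (L i).card = 3) ∧
    ∀ x y : V, x ∈ linesPts L → y ∈ linesPts L → x ≠ y →
      ∃! i : Fin 12, x ∈ L i ∧ y ∈ L i

/-- A Hesse Kaleidoscope on the point set `V`. -/
def IsHesseKaleidoscope [DecidableEq V] (K : Multiset (Fin 12 → Finset V)) : Prop :=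
  (∀ L ∈ K, IsColoredHesse L) ∧
    ∀ x y : V, x ≠ y → ∀ i : Fin 12,
      Multiset.countP (fun L => x ∈ L i ∧ y ∈ L i) K = 1

/-- A `G`-regular Hesse Kaleidoscope. -/
def IsRegularHK (G : Type*) [AddGroup G] [DecidableEq G]
    (K : Multiset (Fin 12 → Finset G)) : Prop :=
  IsHesseKaleidoscope K ∧ ∀ g : G, K.map (fun L => fun i => (L i).image (· + g)) = K

/-- An `(H, k, 1)`-difference matrix: a `k × |H|` matrix with entries in `H` such that the
difference of any two distinct rows contains each element of `H` exactly once. -/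
def IsDiffMatrix (H : Type*) [AddGroup H] [Fintype H] (k : ℕ)
    (M : Fin k → Fin (Fintype.card H) → H) : Prop :=
  ∀ r s : Fin k, r ≠ s → Function.Bijective fun c => M r c - M s c

/-- A 2-`(v, k, lam)` design (block multiset) on the point set `V`. -/
def Is2Design [DecidableEq V] (k lam : ℕ) (𝓑 : Multiset (Finset V)) : Prop :=
  (∀ b ∈ 𝓑, b.card = k) ∧
    ∀ x y : V, x ≠ y → Multiset.countP (fun b => x ∈ b ∧ y ∈ b) 𝓑 = lam

/-- A pairwise balanced design with block sizes in `K` on the point set `V`. -/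
def IsPBD [DecidableEq V] (K : Set ℕ) (𝓑 : Multiset (Finset V)) : Prop :=
  (∀ b ∈ 𝓑, b.card ∈ K) ∧
    ∀ x y : V, x ≠ y → Multiset.countP (fun b => x ∈ b ∧ y ∈ b) 𝓑 = 1

/-- Existence of a Fano Kaleidoscope of order `v`. -/
def ExistsFK (v : ℕ) : Prop :=
  ∃ K : Multiset (Fin 7 → Finset (Fin v)), IsFanoKaleidoscope K

end KaleidoscopeDefs

/-- Third vertex condition: `(a, b, c)` is an equilateral triangle over `ZMod 13`. -/
def Good13 (a b c : ZMod 13) : Prop := c - a = 4 * (b - a) ∨ c - a = 10 * (b - a)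

instance (a b c : ZMod 13) : Decidable (Good13 a b c) := by
  unfold Good13; infer_instance

/-- The list of differences of a triple. -/
def diffs13 (a b c : ZMod 13) : List (ZMod 13) := [a - b, b - a, a - c, c - a, b - c, c - b]

/-- Disjointness of two lists of residues, in decidable form. -/
def Disj13 (l m : List (ZMod 13)) : Prop := ∀ z ∈ l, z ∉ m

instance (l m : List (ZMod 13)) : Decidable (Disj13 l m) := by
  unfold Disj13; infer_instance

set_option maxRecDepth 100000 in
lemma key_dec : ∀ x y : ZMod 13, (diffs13 0 x y).Nodup → ¬ Good13 0 x y →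
    ∀ z, z ∉ diffs13 0 x y → ∀ w, (diffs13 0 z w).Nodup →
      ¬ (Disj13 (diffs13 0 x y) (diffs13 0 z w)) := by decide +kernel

set_option maxRecDepth 100000 in
lemma ex_dec : ∀ x y : ZMod 13, ∃ d, d ≠ 0 ∧ d ∉ diffs13 0 x y := by decide +kernel

lemma diffs13_shift (a b c : ZMod 13) : diffs13 a b c = diffs13 0 (b - a) (c - a) := by
  simp [diffs13]

lemma good13_shift (a b c : ZMod 13) : Good13 a b c ↔ Good13 0 (b - a) (c - a) := by
  simp [Good13]

lemma good13_of_partner (a b c : ZMod 13) (hn : (diffs13 a b c).Nodup)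
    (h : ∀ d, d ≠ 0 → d ∉ diffs13 a b c → ∃ a' b' c', (diffs13 a' b' c').Nodup ∧
      Disj13 (diffs13 a b c) (diffs13 a' b' c')) : Good13 a b c := by
  obtain ⟨d, hd0, hd⟩ := ex_dec (b - a) (c - a)
  rw [← diffs13_shift] at hd
  obtain ⟨a', b', c', hn', hdis⟩ := h d hd0 hd
  rw [good13_shift]
  by_contra hg
  rw [diffs13_shift] at hn
  rw [diffs13_shift a' b' c'] at hn' hdis
  rw [diffs13_shift a b c] at hdis
  refine key_dec _ _ hn hg (b' - a') ?_ _ hn' hdis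
  intro hm
  exact hdis _ hm (by simp [diffs13])

/-- Six points of a normalised configuration being distinct together with the two closing
lines being equilateral. -/
def Config13 (x y p q r s : ZMod 13) : Prop :=
  [0, x, y, p * x, x + q * (y - x), r * y].Nodup ∧
    Good13 0 (x + q * (y - x)) (y + s * (p * x - y)) ∧
    Good13 x (r * y) (y + s * (p * x - y))

instance (x y p q r s : ZMod 13) : Decidable (Config13 x y p q r s) := by
  unfold Config13; infer_instance

set_option maxRecDepth 100000 in
lemma core_dec : ∀ x y : ZMod 13,
    ∀ p ∈ [(4 : ZMod 13), 10], ∀ q ∈ [(4 : ZMod 13), 10], ∀ r ∈ [(4 : ZMod 13), 10],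
    ∀ s ∈ [(4 : ZMod 13), 10], ¬ Config13 x y p q r s := by decide +kernel

lemma core (b0 b1 b2 b3 b4 b5 b6 : ZMod 13) (hn : [b0, b1, b2, b3, b4, b6].Nodup)
    (h013 : Good13 b0 b1 b3) (h124 : Good13 b1 b2 b4) (h026 : Good13 b0 b2 b6)
    (h235 : Good13 b2 b3 b5) (h045 : Good13 b0 b4 b5) (h165 : Good13 b1 b6 b5) : False := by
  have aux : ∀ a b c : ZMod 13, Good13 a b c →
      ∃ p ∈ [(4 : ZMod 13), 10], c = a + p * (b - a) := by
    rintro a b c (h | h)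
    · exact ⟨4, by simp, by linear_combination h⟩
    · exact ⟨10, by simp, by linear_combination h⟩
  obtain ⟨p, hp, e3⟩ := aux _ _ _ h013
  obtain ⟨q, hq, e4⟩ := aux _ _ _ h124
  obtain ⟨r, hr, e6⟩ := aux _ _ _ h026
  obtain ⟨s, hs, e5⟩ := aux _ _ _ h235
  have f1 : b1 = (b1 - b0) + b0 := by ring
  have f2 : b2 = (b2 - b0) + b0 := by ring
  generalize b1 - b0 = x at f1
  generalize b2 - b0 = y at f2
  have g3 : b3 = p * x + b0 := by rw [e3, f1]; ring
  have g4 : b4 = (x + q * (y - x)) + b0 := by rw [e4, f1, f2]; ring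
  have g6 : b6 = r * y + b0 := by rw [e6, f2]; ring
  have g5 : b5 = (y + s * (p * x - y)) + b0 := by rw [e5, g3, f2]; ring
  have hn' : [0, x, y, p * x, x + q * (y - x), r * y].Nodup := by
    refine List.Nodup.of_map (fun z => z + b0) ?_
    simp only [List.map_cons, List.map_nil, zero_add, ← f1, ← f2, ← g3, ← g4, ← g6]
    exact hn
  refine core_dec x y p hp q hq r hr s hs ⟨hn', ?_, ?_⟩
  · rw [g4, g5] at h045; simpa [Good13] using h045
  · rw [g5, g6, f1] at h165; simpa [Good13] using h165

lemma diffMultiset_triple (a b c : ZMod 13) (hab : a ≠ b) (hac : a ≠ c) (hbc : b ≠ c) :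
    diffMultiset ({a, b, c} : Finset (ZMod 13)) = (diffs13 a b c : Multiset (ZMod 13)) := by
  have : ((({a, b, c} : Finset (ZMod 13)) ×ˢ {a, b, c}).filter fun p => p.1 ≠ p.2)
      = {(a, b), (b, a), (a, c), (c, a), (b, c), (c, b)} := by
    ext ⟨u, v⟩
    simp only [Finset.mem_filter, Finset.mem_product, Finset.mem_insert, Finset.mem_singleton,
      Prod.mk.injEq]
    grind
  unfold diffMultiset
  rw [this]
  rw [Finset.insert_val_of_notMem, Finset.insert_val_of_notMem, Finset.insert_val_of_notMem,
    Finset.insert_val_of_notMem, Finset.insert_val_of_notMem]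
  · rfl
  all_goals simp only [Finset.mem_insert, Finset.mem_singleton, Prod.mk.injEq]; grind

lemma no_FKDF13 (F : Multiset (Fin 7 → ZMod 13)) (hF : IsFKDF F) : False := by
  obtain ⟨hinj, hdf⟩ := hF
  have hD : ∀ B : Fin 7 → ZMod 13, Function.Injective B → ∀ j,
      diffMultiset (fanoLine B j) = (diffs13 (B j) (B (j+1)) (B (j+3)) : Multiset (ZMod 13)) := by
    intro B hB j
    apply diffMultiset_triple <;> apply hB.ne <;> revert j <;> decide
  obtain ⟨B, hB⟩ : ∃ B, B ∈ F := by
    by_contra hne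
    push Not at hne
    have := (hdf 0).2 1 (by decide)
    rw [Multiset.eq_zero_of_forall_notMem hne] at this
    simp at this
  obtain ⟨F', rfl⟩ := Multiset.exists_cons_of_mem hB
  have hBi := hinj B hB
  have nz : ∀ C : Fin 7 → ZMod 13, Function.Injective C → ∀ j,
      (0 : ZMod 13) ∉ diffs13 (C j) (C (j+1)) (C (j+3)) := by
    intro C hC j
    have e : ∀ j : Fin 7, j ≠ j + 1 ∧ j ≠ j + 3 ∧ j + 1 ≠ j + 3 := by decide
    have h1 : C j ≠ C (j+1) := hC.ne (e j).1
    have h2 : C j ≠ C (j+3) := hC.ne (e j).2.1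
    have h3 : C (j+1) ≠ C (j+3) := hC.ne (e j).2.2
    simp only [diffs13, List.mem_cons, List.not_mem_nil]
    grind
  have good : ∀ j, Good13 (B j) (B (j+1)) (B (j+3)) := by
    intro j
    have hc := (hdf j).2
    simp only [Multiset.map_cons, Multiset.cons_bind, Multiset.count_add] at hc
    rw [hD B hBi j] at hc
    simp only [Multiset.coe_count] at hc
    apply good13_of_partner
    · rw [List.nodup_iff_count_le_one]
      intro g
      by_cases hg : g = 0
      · subst hg; rw [List.count_eq_zero_of_not_mem (nz B hBi j)]; omega
      · have := hc g hg; omega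
    · intro d hd0 hd
      have h1 := hc d hd0
      rw [List.count_eq_zero_of_not_mem hd, zero_add] at h1
      have hm : d ∈ (Multiset.map (fun B => fanoLine B j) F').bind diffMultiset := by
        rw [← Multiset.count_pos]; omega
      simp only [Multiset.mem_bind, Multiset.mem_map] at hm
      obtain ⟨_, ⟨C, hC, rfl⟩, hdC⟩ := hm
      have hCi := hinj C (Multiset.mem_cons_of_mem hC)
      obtain ⟨F'', rfl⟩ := Multiset.exists_cons_of_mem hC
      simp only [Multiset.map_cons, Multiset.cons_bind, Multiset.count_add] at hc
      rw [hD C hCi j] at hc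
      simp only [Multiset.coe_count] at hc
      refine ⟨_, _, _, (?_ : (diffs13 (C j) (C (j+1)) (C (j+3))).Nodup), ?_⟩
      · rw [List.nodup_iff_count_le_one]
        intro g
        by_cases hg : g = 0
        · subst hg; rw [List.count_eq_zero_of_not_mem (nz C hCi j)]; omega
        · have := hc g hg; omega
      · intro z hz hz'
        have hz0 : z ≠ 0 := by rintro rfl; exact nz B hBi j hz
        have := hc z hz0
        have := List.count_pos_iff.2 hz
        have := List.count_pos_iff.2 hz'
        omega
  have hs : ∀ a b c : ZMod 13, Good13 a b c → Good13 b a c ∧ Good13 a c b := by decide +kernel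
  refine core (B 0) (B 1) (B 2) (B 3) (B 4) (B 5) (B 6) ?_ (good 0) (good 1) ?_ (good 2) ?_ ?_
  · exact List.Nodup.map hBi (by decide : [(0 : Fin 7), 1, 2, 3, 4, 6].Nodup)
  · have : Good13 (B 6) (B 0) (B 2) := good 6
    exact (hs _ _ _ (hs _ _ _ this).1).2
  · have : Good13 (B 4) (B 5) (B 0) := good 4
    exact (hs _ _ _ (hs _ _ _ (hs _ _ _ this).1).2).1 |> fun h => (hs _ _ _ (hs _ _ _ h).2).1 |>
      fun h => (hs _ _ _ (hs _ _ _ h).1).2 |> fun h => by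
        first | exact h | exact (hs _ _ _ h).1 | exact (hs _ _ _ h).2
  · have : Good13 (B 5) (B 6) (B 1) := good 5
    have := (hs _ _ _ (hs _ _ _ this).1).2
    exact (hs _ _ _ this).1

/-- No Fano plane (given by its collinearity relation `T`) in `ZMod 13` has all lines
equilateral. -/
lemma no_good_fano (P : Finset (ZMod 13)) (hc7 : P.card = 7)
    (T : ZMod 13 → ZMod 13 → ZMod 13 → Prop)
    (s1 : ∀ x y z, T x y z → T x z y) (s2 : ∀ x y z, T x y z → T y x z)
    (uq : ∀ x y z w, T x y z → T x y w → z = w) (ne : ∀ x y z, T x y z → x ≠ y)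
    (third : ∀ x ∈ P, ∀ y ∈ P, x ≠ y → ∃ z ∈ P, T x y z)
    (good : ∀ x y z, T x y z → Good13 x y z) : False := by
  obtain ⟨b0, hb0, b1, hb1, h01⟩ := Finset.one_lt_card.1 (show 1 < P.card by omega)
  obtain ⟨b3, hb3, l013⟩ := third b0 hb0 b1 hb1 h01
  obtain ⟨b2, hb2, hb2n⟩ : ∃ z ∈ P, z ∉ ({b0, b1, b3} : Finset (ZMod 13)) := by
    apply Finset.exists_mem_notMem_of_card_lt_card
    exact lt_of_le_of_lt Finset.card_le_three (by omega)
  simp only [Finset.mem_insert, Finset.mem_singleton, not_or] at hb2n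
  obtain ⟨h20, h21, h23⟩ := hb2n
  obtain ⟨b4, hb4, l124⟩ := third b1 hb1 b2 hb2 (Ne.symm h21)
  obtain ⟨b6, hb6, l026⟩ := third b0 hb0 b2 hb2 (Ne.symm h20)
  have h40 : b4 ≠ b0 := by clear third good hc7; rintro rfl; grind
  have h61 : b6 ≠ b1 := by clear third good hc7; rintro rfl; grind
  obtain ⟨u, hu, l23⟩ := third b2 hb2 b3 hb3 h23
  obtain ⟨v, hv, l04⟩ := third b0 hb0 b4 hb4 (Ne.symm h40)
  obtain ⟨w, hw, l16⟩ := third b1 hb1 b6 hb6 (Ne.symm h61)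
  have g1 := good _ _ _ l013
  have g2 := good _ _ _ l124
  have g3 := good _ _ _ l026
  have g4 := good _ _ _ l23
  have g5 := good _ _ _ l04
  have g6 := good _ _ _ l16
  clear third good
  have hn : [b0, b1, b2, b3, b4, b6].Nodup := by
    clear hc7 g1 g2 g3 g4 g5 g6 l23 l04 l16
    simp only [List.nodup_cons, List.mem_cons, List.not_mem_nil, not_or]
    grind
  have hsame : ∀ s ∈ P, ∀ t ∈ P, s ∉ [b0, b1, b2, b3, b4, b6] →
      t ∉ [b0, b1, b2, b3, b4, b6] → s = t := by
    intro s hs t ht hs' ht'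
    rw [← List.mem_toFinset] at hs' ht'
    have hcard : (P \ [b0, b1, b2, b3, b4, b6].toFinset).card ≤ 1 := by
      rw [Finset.card_sdiff_of_subset, List.toFinset_card_of_nodup hn, hc7]
      · simp
      · intro z hz
        simp only [List.mem_toFinset, List.mem_cons, List.not_mem_nil, or_false] at hz
        rcases hz with rfl | rfl | rfl | rfl | rfl | rfl <;> assumption
    exact Finset.card_le_one.1 hcard s (Finset.mem_sdiff.2 ⟨hs, hs'⟩) t
      (Finset.mem_sdiff.2 ⟨ht, ht'⟩)
  have n3 : u ∉ [b0, b1, b2, b3, b4, b6] ∧ v ∉ [b0, b1, b2, b3, b4, b6] ∧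
      w ∉ [b0, b1, b2, b3, b4, b6] := by
    clear hsame hc7 g1 g2 g3 g4 g5 g6
    simp only [List.nodup_cons, List.mem_cons, List.not_mem_nil, not_or] at hn
    simp only [List.mem_cons, List.not_mem_nil, or_false]
    refine ⟨?_, ?_, ?_⟩
    · rintro (rfl | rfl | rfl | rfl | rfl | rfl) <;> grind
    · rintro (rfl | rfl | rfl | rfl | rfl | rfl) <;> grind
    · rintro (rfl | rfl | rfl | rfl | rfl | rfl) <;> grind
  obtain ⟨nu, nv, nw⟩ := n3
  obtain rfl := hsame u hu v hv nu nv
  obtain rfl := hsame u hu w hw nu nw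
  exact core b0 b1 b2 b3 b4 u b6 hn g1 g2 g3 g4 g5 g6

lemma no_regularFK13 (K : Multiset (Fin 7 → Finset (ZMod 13)))
    (hK : IsRegularFK (ZMod 13) K) : False := by
  obtain ⟨⟨hfano, hcount⟩, htr⟩ := hK
  have htr' : ∀ g, ∀ L ∈ K, (fun i => (L i).image (· + g)) ∈ K := by
    intro g L hL
    have := htr g
    rw [← this]
    exact Multiset.mem_map_of_mem (fun L => fun i => (L i).image (· + g)) hL
  have huniq : ∀ L ∈ K, ∀ M ∈ K, ∀ i x y, x ≠ y → x ∈ L i → y ∈ L i → x ∈ M i → y ∈ M i →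
      L = M := by
    intro L hL M hM i x y hxy h1 h2 h3 h4
    have h := hcount x y hxy i
    rw [Multiset.countP_eq_card_filter, Multiset.card_eq_one] at h
    obtain ⟨N, hN⟩ := h
    have a1 : L ∈ Multiset.filter (fun L => x ∈ L i ∧ y ∈ L i) K :=
      Multiset.mem_filter.2 ⟨hL, h1, h2⟩
    have a2 : M ∈ Multiset.filter (fun L => x ∈ L i ∧ y ∈ L i) K :=
      Multiset.mem_filter.2 ⟨hM, h3, h4⟩
    rw [hN, Multiset.mem_singleton] at a1 a2
    rw [a1, a2]
  have hexists : ∀ x y, x ≠ y → ∀ i, ∃ L ∈ K, x ∈ L i ∧ y ∈ L i := by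
    intro x y hxy i
    have h := hcount x y hxy i
    have : 0 < Multiset.countP (fun L => x ∈ L i ∧ y ∈ L i) K := by omega
    exact Multiset.countP_pos.1 this
  -- equal differences force a translate
  have htrans : ∀ L ∈ K, ∀ M ∈ K, ∀ i x y x' y', x ≠ y → x ∈ L i → y ∈ L i → x' ∈ M i →
      y' ∈ M i → x - y = x' - y' → (fun j => (L j).image (· + (x' - x))) = M := by
    intro L hL M hM i x y x' y' hxy h1 h2 h3 h4 he
    refine huniq _ (htr' _ L hL) M hM i x' y' ?_ ?_ ?_ h3 h4
    · rintro rfl; apply hxy; rw [sub_self] at he; exact sub_eq_zero.1 he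
    · exact Finset.mem_image.2 ⟨x, h1, by ring⟩
    · exact Finset.mem_image.2 ⟨y, h2, by linear_combination -he⟩
  have hzero : ∀ (S : Finset (ZMod 13)) g, S.card = 3 → S.image (· + g) = S → g = 0 := by
    intro S g hS h
    have h1 : ∑ z ∈ S.image (· + g), z = ∑ z ∈ S, z := by rw [h]
    rw [Finset.sum_image (by intro a _ b _ hab; exact add_right_cancel hab),
      Finset.sum_add_distrib, Finset.sum_const, hS] at h1
    have h2 : 3 • g = 0 := by simpa using h1
    have e : ∀ g : ZMod 13, 3 • g = 0 → g = 0 := by decide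
    exact e g h2
  have hself : ∀ L ∈ K, ∀ i x y x' y', x ≠ y → x ∈ L i → y ∈ L i → x' ∈ L i →
      y' ∈ L i → x - y = x' - y' → x = x' ∧ y = y' := by
    intro L hL i x y x' y' hxy h1 h2 h3 h4 he
    have := htrans L hL L hL i x y x' y' hxy h1 h2 h3 h4 he
    have h0 := hzero (L i) _ ((hfano L hL).2.1 i) (congrFun this i)
    constructor
    · linear_combination -h0
    · linear_combination -h0 - he
  have hnodup : ∀ L ∈ K, ∀ i a b c, a ≠ b → a ≠ c → b ≠ c → L i = {a, b, c} →
      (diffs13 a b c).Nodup := by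
    intro L hL i a b c hab hac hbc he
    have ha : a ∈ L i := by simp [he]
    have hb : b ∈ L i := by simp [he]
    have hc : c ∈ L i := by simp [he]
    have := hself L hL i
    simp only [diffs13, List.nodup_cons, List.mem_cons, List.not_mem_nil, not_or]
    grind
  have hmem : ∀ a b c d : ZMod 13, d ∈ diffs13 a b c →
      ∃ x ∈ ({a, b, c} : Finset (ZMod 13)), ∃ y ∈ ({a, b, c} : Finset (ZMod 13)), d = x - y := by
    intro a b c d hd
    simp only [diffs13, List.mem_cons, List.not_mem_nil, or_false] at hd
    rcases hd with h | h | h | h | h | h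
    · exact ⟨a, by simp, b, by simp, h⟩
    · exact ⟨b, by simp, a, by simp, h⟩
    · exact ⟨a, by simp, c, by simp, h⟩
    · exact ⟨c, by simp, a, by simp, h⟩
    · exact ⟨b, by simp, c, by simp, h⟩
    · exact ⟨c, by simp, b, by simp, h⟩
  have hmem' : ∀ a b c x y : ZMod 13, x ∈ ({a, b, c} : Finset (ZMod 13)) →
      y ∈ ({a, b, c} : Finset (ZMod 13)) → x ≠ y → x - y ∈ diffs13 a b c := by
    intro a b c x y hx hy hxy
    simp only [Finset.mem_insert, Finset.mem_singleton] at hx hy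
    simp only [diffs13, List.mem_cons, List.not_mem_nil, or_false]
    grind
  have hgood : ∀ L ∈ K, ∀ i a b c, a ≠ b → a ≠ c → b ≠ c → L i = {a, b, c} →
      Good13 a b c := by
    intro L hL i a b c hab hac hbc he
    have hn := hnodup L hL i a b c hab hac hbc he
    apply good13_of_partner _ _ _ hn
    intro d hd0 hd
    obtain ⟨M, hM, hMd, hM0⟩ := hexists d 0 hd0 i
    obtain ⟨a', b', c', h1, h2, h3, hMi⟩ := Finset.card_eq_three.1 ((hfano M hM).2.1 i)
    have hn' := hnodup M hM i a' b' c' h1 h2 h3 hMi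
    refine ⟨a', b', c', hn', ?_⟩
    intro z hz hz'
    obtain ⟨x, hx, y, hy, hxy⟩ := hmem _ _ _ _ hz
    obtain ⟨x', hx', y', hy', hxy'⟩ := hmem _ _ _ _ hz'
    rw [← he] at hx hy
    rw [← hMi] at hx' hy'
    have hne : x' ≠ y' := by
      rintro rfl
      rw [sub_self] at hxy'
      subst hxy'
      simp only [diffs13, List.mem_cons, List.not_mem_nil] at hz
      grind
    have hLM := congrFun (htrans M hM L hL i x' y' x y hne hx' hy' hx hy
      (hxy'.symm.trans hxy)) i
    apply hd
    have k1 : d + (x - x') ∈ L i := by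
      rw [← hLM]; exact Finset.mem_image_of_mem (· + (x - x')) hMd
    have k2 : 0 + (x - x') ∈ L i := by
      rw [← hLM]; exact Finset.mem_image_of_mem (· + (x - x')) hM0
    rw [he] at k1 k2
    have := hmem' a b c _ _ k1 k2 (by simpa using hd0)
    simpa using this
  obtain ⟨L, hL, -, -⟩ := hexists 1 0 (by decide) 0
  obtain ⟨hc7, hc3, hu⟩ := hfano L hL
  have hG := hgood L hL
  clear hgood hnodup hself htrans huniq hexists htr htr' hcount hfano hmem hmem' hzero
  set P := linesPts L with hP
  have hsub : ∀ i, ∀ x ∈ L i, x ∈ P := by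
    intro i x hx
    exact Finset.mem_biUnion.2 ⟨i, Finset.mem_univ _, hx⟩
  -- third points
  have hthird : ∀ x ∈ P, ∀ y ∈ P, x ≠ y → ∃ z ∈ P, z ≠ x ∧ z ≠ y ∧ ∃ i, L i = {x, y, z} := by
    intro x hx y hy hxy
    obtain ⟨i, ⟨h1, h2⟩, -⟩ := hu x y hx hy hxy
    obtain ⟨z, hz, hne⟩ : ∃ z ∈ L i, z ∉ ({x, y} : Finset (ZMod 13)) := by
      apply Finset.exists_mem_notMem_of_card_lt_card
      rw [hc3 i, Finset.card_pair hxy]; omega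
    simp only [Finset.mem_insert, Finset.mem_singleton, not_or] at hne
    refine ⟨z, hsub i z hz, hne.1, hne.2, i, ?_⟩
    symm
    apply Finset.eq_of_subset_of_card_le
    · intro w hw
      simp only [Finset.mem_insert, Finset.mem_singleton] at hw
      rcases hw with rfl | rfl | rfl <;> assumption
    · rw [hc3 i, Finset.card_eq_three.2 ⟨x, y, z, hxy, Ne.symm hne.1, Ne.symm hne.2, rfl⟩]
  have hU : ∀ i j x y, x ∈ L i → y ∈ L i → x ∈ L j → y ∈ L j → x ≠ y → i = j := by
    intro i j x y h1 h2 h3 h4 hxy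
    exact (hu x y (hsub i x h1) (hsub i y h2) hxy).unique ⟨h1, h2⟩ ⟨h3, h4⟩
  refine no_good_fano P hc7
    (fun x y z => x ≠ y ∧ x ≠ z ∧ y ≠ z ∧ ∃ i, L i = {x, y, z}) ?_ ?_ ?_ ?_ ?_ ?_
  · rintro x y z ⟨h1, h2, h3, i, h⟩
    refine ⟨h2, h1, h3.symm, i, ?_⟩
    rw [h]; ext; simp only [Finset.mem_insert, Finset.mem_singleton]; tauto
  · rintro x y z ⟨h1, h2, h3, i, h⟩
    refine ⟨h1.symm, h3, h2, i, ?_⟩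
    rw [h]; ext; simp only [Finset.mem_insert, Finset.mem_singleton]; tauto
  · rintro x y z w ⟨hxy, hxz, hyz, i, h1⟩ ⟨-, -, -, j, h2⟩
    have := hU i j x y (by simp [h1]) (by simp [h1]) (by simp [h2]) (by simp [h2]) hxy
    subst this
    have : z ∈ L i := by simp [h1]
    rw [h2] at this
    simp only [Finset.mem_insert, Finset.mem_singleton] at this
    rcases this with h | h | h
    · exact absurd h.symm hxz
    · exact absurd h.symm hyz
    · exact h
  · rintro x y z ⟨h, -⟩; exact h
  · intro x hx y hy hxy
    obtain ⟨z, hz, h1, h2, h3⟩ := hthird x hx y hy hxy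
    exact ⟨z, hz, hxy, h1.symm, h2.symm, h3⟩
  · rintro x y z ⟨h1, h2, h3, i, h⟩
    exact hG i x y z h1 h2 h3 h

/-- there is no `ℤ/13ℤ`-regular Fano Kaleidoscope FK(13); equivalently,
there is no Fano Kaleidoscopic difference family in `ℤ/13ℤ`. -/
theorem no_regular_FK13 :
    (¬ ∃ K : Multiset (Fin 7 → Finset (ZMod 13)), IsRegularFK (ZMod 13) K) ∧
      (¬ ∃ 𝓕 : Multiset (Fin 7 → ZMod 13), IsFKDF 𝓕) := by
  exact ⟨fun ⟨K, hK⟩ => no_regularFK13 K hK, fun ⟨F, hF⟩ => no_FKDF13 F hF⟩
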